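/- Let F be algebraically closed of characteristic 3. A nonzero idempotent f of the split Okubo algebra (O,*) is quaternionic (i.e., its centralizer C = {x ∈ O | x*f = f*x} has dimension 6) if and only if f = e, where e = Σ_{g ∈ I} e_g is the sum of all eight basis elements. In particular, the split Okubo algebra in characteristic 3 contains a unique quaternionic idempotent. -/

import Mathlib

open scoped BigOperators

/-- The grading group `ℤ₃ × ℤ₃`. -/
abbrev OkG : Type := ZMod 3 × ZMod 3

/-- The index set of the standard basis of the split Okubo algebra:
the nonzero elements of `ℤ₃ × ℤ₃`. -/
abbrev OkI : Type := {g : OkG // g ≠ 0}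

variable (R : Type) [CommRing R]

/-- The structure constants `c(g,h) = 1 - ((g₁h₂ - g₂h₁).val : ℤ)` of the split Okubo algebra. -/
def okc (g h : OkG) : R :=
  ((1 - (((g.1 * h.2 - g.2 * h.1 : ZMod 3)).val : ℤ) : ℤ) : R)

/-- Underlying function of the split Okubo multiplication. -/
def okMulFun (x y : OkI → R) : OkI → R := fun k =>
  ∑ g : OkI, ∑ h : OkI,
    (if (g : OkG) + (h : OkG) = (k : OkG) then okc R (g : OkG) (h : OkG) else 0) * (x g * y h)

/-- The split Okubo multiplication, as a bilinear map: the unique `R`-bilinear map with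
`e_g * e_h = 0` if `g + h = 0` and `e_g * e_h = c(g,h) • e_(g+h)` otherwise. -/
def okMul : (OkI → R) →ₗ[R] (OkI → R) →ₗ[R] (OkI → R) :=
  LinearMap.mk₂ R (okMulFun R)
    (by intro m₁ m₂ n; funext k; simp [okMulFun, add_mul, mul_add, Finset.sum_add_distrib])
    (by intro c m n; funext k
        simp only [okMulFun, Pi.smul_apply, smul_eq_mul, Finset.mul_sum]
        exact Finset.sum_congr rfl fun g _ => Finset.sum_congr rfl fun h _ => by ring)
    (by intro m n₁ n₂; funext k; simp [okMulFun, add_mul, mul_add, Finset.sum_add_distrib])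
    (by intro c m n; funext k
        simp only [okMulFun, Pi.smul_apply, smul_eq_mul, Finset.mul_sum]
        exact Finset.sum_congr rfl fun g _ => Finset.sum_congr rfl fun h _ => by ring)

/-- The norm (quadratic form) of the split Okubo algebra: the unique quadratic form
with `n(e_g) = 0` and polar form `b(e_g, e_h) = 1` if `g + h = 0`, and `0` otherwise. -/
def okN (x : OkI → R) : R :=
  x ⟨(1, 0), by decide⟩ * x ⟨(2, 0), by decide⟩ +
  x ⟨(0, 1), by decide⟩ * x ⟨(0, 2), by decide⟩ +
  x ⟨(1, 1), by decide⟩ * x ⟨(2, 2), by decide⟩ +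
  x ⟨(1, 2), by decide⟩ * x ⟨(2, 1), by decide⟩

/-- The polar form of the norm `okN`. -/
def okB (x y : OkI → R) : R := okN R (x + y) - okN R x - okN R y

/-- The basis element `e_g` of the split Okubo algebra. -/
def okE (g : OkI) : OkI → R := Pi.single g 1

/-- The sum `e = ∑_{g ∈ I} e_g` of all eight basis elements. -/
def oke : OkI → R := ∑ g : OkI, okE R g

/-- The centralizer `{x | x * f = f * x}` of `f` in the split Okubo algebra. -/
def okCent (f : OkI → R) : Submodule R (OkI → R) where
  carrier := {x | okMul R x f = okMul R f x}
  add_mem' := by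
    intro a b ha hb
    simp only [Set.mem_setOf_eq] at ha hb ⊢
    simp [map_add, LinearMap.add_apply, ha, hb]
  zero_mem' := by simp
  smul_mem' := by
    intro c a ha
    simp only [Set.mem_setOf_eq] at ha ⊢
    simp [map_smul, LinearMap.smul_apply, ha]

lemma okN_add (x y : OkI → R) : okN R (x + y) = okN R x + okN R y + okB R x y := by
  simp [okB]

lemma okB_add_left (x y z : OkI → R) : okB R (x + y) z = okB R x z + okB R y z := by
  simp [okB, okN]; ring

lemma okN_smul (c : R) (x : OkI → R) : okN R (c • x) = c * c * okN R x := by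
  simp [okN, smul_eq_mul]; ring

lemma okB_smul_left (c : R) (x y : OkI → R) : okB R (c • x) y = c * okB R x y := by
  simp [okB, okN, smul_eq_mul]; ring

/-- The radical of the restriction of the norm `okN` (with polar form `okB`) to the
centralizer of `f`. -/
def okRad (f : OkI → R) : Submodule R (OkI → R) where
  carrier := {v | v ∈ okCent R f ∧ okN R v = 0 ∧ ∀ w ∈ okCent R f, okB R v w = 0}
  add_mem' := by
    intro a b ha hb
    refine ⟨(okCent R f).add_mem ha.1 hb.1, ?_, ?_⟩
    · rw [okN_add, ha.2.1, hb.2.1, ha.2.2 b hb.1]; ring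
    · intro w hw; rw [okB_add_left, ha.2.2 w hw, hb.2.2 w hw]; ring
  zero_mem' := by
    refine ⟨(okCent R f).zero_mem, by simp [okN], ?_⟩
    intro w hw; simp [okB, okN]
  smul_mem' := by
    intro c a ha
    refine ⟨(okCent R f).smul_mem c ha.1, ?_, ?_⟩
    · rw [okN_smul, ha.2.1]; ring
    · intro w hw; rw [okB_smul_left, ha.2.2 w hw]; ring

lemma okI_sum {M : Type*} [AddCommMonoid M] (φ : OkI → M) :
    ∑ g : OkI, φ g = φ ⟨(1, 0), by decide⟩ + φ ⟨(2, 0), by decide⟩ + φ ⟨(0, 1), by decide⟩ +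
      φ ⟨(0, 2), by decide⟩ + φ ⟨(1, 1), by decide⟩ + φ ⟨(2, 2), by decide⟩ +
      φ ⟨(1, 2), by decide⟩ + φ ⟨(2, 1), by decide⟩ := by
  have h : (Finset.univ : Finset OkI) = {⟨(1, 0), by decide⟩, ⟨(2, 0), by decide⟩,
      ⟨(0, 1), by decide⟩, ⟨(0, 2), by decide⟩, ⟨(1, 1), by decide⟩, ⟨(2, 2), by decide⟩,
      ⟨(1, 2), by decide⟩, ⟨(2, 1), by decide⟩} := by decide
  rw [h]
  repeat rw [Finset.sum_insert (by decide)]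
  rw [Finset.sum_singleton]
  simp only [add_assoc]

lemma okMul_apply {R : Type} [CommRing R] (x y : OkI → R) (k : OkI) :
    okMul R x y k = ∑ g : OkI, if h : (k : OkG) - g ≠ 0 then
      okc R g (k - g) * (x g * y ⟨k - g, h⟩) else 0 := by
  change okMulFun R x y k = _
  unfold okMulFun
  refine Finset.sum_congr rfl fun g _ => ?_
  split_ifs with h
  · rw [Finset.sum_eq_single ⟨k - g, h⟩]
    · simp
    · intro b _ hb
      rw [if_neg, zero_mul]
      intro e
      exact hb (Subtype.ext (eq_sub_of_add_eq' e))
    · simp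
  · push Not at h
    refine Finset.sum_eq_zero fun b _ => ?_
    rw [if_neg, zero_mul]
    intro e
    exact b.2 ((eq_sub_of_add_eq' e).trans h)

lemma okc_eq {R : Type} [CommRing R] (g h : OkG) :
    okc R g h = if g.1 * h.2 - g.2 * h.1 = 0 then 1
      else if g.1 * h.2 - g.2 * h.1 = 1 then 0 else -1 := by
  unfold okc
  generalize g.1 * h.2 - g.2 * h.1 = d
  obtain rfl | rfl | rfl : d = 0 ∨ d = 1 ∨ d = 2 := by revert d; decide
  · change (((1 - ((0 : ℕ) : ℤ)) : ℤ) : R) = _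
    simp
  · change (((1 - ((1 : ℕ) : ℤ)) : ℤ) : R) = _
    simp
  · change (((1 - ((2 : ℕ) : ℤ)) : ℤ) : R) = _
    simp +decide

/-- All components of the product. -/
lemma okMul_components {R : Type} [CommRing R] (x y : OkI → R) :
    okMul R x y ⟨(1, 0), by decide⟩ =
      x ⟨(2, 0), by decide⟩ * y ⟨(2, 0), by decide⟩ -
        x ⟨(0, 1), by decide⟩ * y ⟨(1, 2), by decide⟩ -
        x ⟨(1, 1), by decide⟩ * y ⟨(0, 2), by decide⟩ -
        x ⟨(2, 1), by decide⟩ * y ⟨(2, 2), by decide⟩ ∧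
    okMul R x y ⟨(2, 0), by decide⟩ =
      x ⟨(1, 0), by decide⟩ * y ⟨(1, 0), by decide⟩ -
        x ⟨(0, 2), by decide⟩ * y ⟨(2, 1), by decide⟩ -
        x ⟨(2, 2), by decide⟩ * y ⟨(0, 1), by decide⟩ -
        x ⟨(1, 2), by decide⟩ * y ⟨(1, 1), by decide⟩ ∧
    okMul R x y ⟨(0, 1), by decide⟩ =
      -x ⟨(2, 0), by decide⟩ * y ⟨(1, 1), by decide⟩ +
        x ⟨(0, 2), by decide⟩ * y ⟨(0, 2), by decide⟩ -
        x ⟨(2, 2), by decide⟩ * y ⟨(1, 2), by decide⟩ -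
        x ⟨(2, 1), by decide⟩ * y ⟨(1, 0), by decide⟩ ∧
    okMul R x y ⟨(0, 2), by decide⟩ =
      -x ⟨(1, 0), by decide⟩ * y ⟨(2, 2), by decide⟩ +
        x ⟨(0, 1), by decide⟩ * y ⟨(0, 1), by decide⟩ -
        x ⟨(1, 1), by decide⟩ * y ⟨(2, 1), by decide⟩ -
        x ⟨(1, 2), by decide⟩ * y ⟨(2, 0), by decide⟩ ∧
    okMul R x y ⟨(1, 1), by decide⟩ =
      -x ⟨(2, 0), by decide⟩ * y ⟨(2, 1), by decide⟩ -
        x ⟨(0, 1), by decide⟩ * y ⟨(1, 0), by decide⟩ +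
        x ⟨(2, 2), by decide⟩ * y ⟨(2, 2), by decide⟩ -
        x ⟨(1, 2), by decide⟩ * y ⟨(0, 2), by decide⟩ ∧
    okMul R x y ⟨(2, 2), by decide⟩ =
      -x ⟨(1, 0), by decide⟩ * y ⟨(1, 2), by decide⟩ -
        x ⟨(0, 2), by decide⟩ * y ⟨(2, 0), by decide⟩ +
        x ⟨(1, 1), by decide⟩ * y ⟨(1, 1), by decide⟩ -
        x ⟨(2, 1), by decide⟩ * y ⟨(0, 1), by decide⟩ ∧
    okMul R x y ⟨(1, 2), by decide⟩ =
      -x ⟨(1, 0), by decide⟩ * y ⟨(0, 2), by decide⟩ -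
        x ⟨(0, 1), by decide⟩ * y ⟨(1, 1), by decide⟩ -
        x ⟨(2, 2), by decide⟩ * y ⟨(2, 0), by decide⟩ +
        x ⟨(2, 1), by decide⟩ * y ⟨(2, 1), by decide⟩ ∧
    okMul R x y ⟨(2, 1), by decide⟩ =
      -x ⟨(2, 0), by decide⟩ * y ⟨(0, 1), by decide⟩ -
        x ⟨(0, 2), by decide⟩ * y ⟨(2, 2), by decide⟩ -
        x ⟨(1, 1), by decide⟩ * y ⟨(1, 0), by decide⟩ +
        x ⟨(1, 2), by decide⟩ * y ⟨(1, 2), by decide⟩ := by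
  refine ⟨?_, ?_, ?_, ?_, ?_, ?_, ?_, ?_⟩ <;>
  · rw [okMul_apply, okI_sum]
    simp only [okc_eq]
    simp +decide
    try simp only [show (1 - 2 : ZMod 3) = 2 by decide, show (-1 : ZMod 3) = 2 by decide,
      show (-2 : ZMod 3) = 1 by decide]
    ring_nf

/-- The coefficient of `u ^ i * v ^ j` in `∑ g, x g * (1 + u) ^ g.1 * (1 + v) ^ g.2`. In
characteristic `3` this identifies the Okubo algebra with a hyperplane complement to the constants
in the truncated polynomial algebra `F[u, v] / (u ^ 3, v ^ 3)`. -/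
def okCoord (R : Type) [CommRing R] (i j : ℕ) : (OkI → R) →ₗ[R] R :=
  ∑ g : OkI, ((g.1.1.val.choose i * g.1.2.val.choose j : ℕ) : R) • LinearMap.proj g

lemma okCoord_expand {R : Type} [CommRing R] (i j : ℕ) (x : OkI → R) :
    okCoord R i j x =
      (Nat.choose 1 i * Nat.choose 0 j : ℕ) * x ⟨(1, 0), by decide⟩ +
      (Nat.choose 2 i * Nat.choose 0 j : ℕ) * x ⟨(2, 0), by decide⟩ +
      (Nat.choose 0 i * Nat.choose 1 j : ℕ) * x ⟨(0, 1), by decide⟩ +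
      (Nat.choose 0 i * Nat.choose 2 j : ℕ) * x ⟨(0, 2), by decide⟩ +
      (Nat.choose 1 i * Nat.choose 1 j : ℕ) * x ⟨(1, 1), by decide⟩ +
      (Nat.choose 2 i * Nat.choose 2 j : ℕ) * x ⟨(2, 2), by decide⟩ +
      (Nat.choose 1 i * Nat.choose 2 j : ℕ) * x ⟨(1, 2), by decide⟩ +
      (Nat.choose 2 i * Nat.choose 1 j : ℕ) * x ⟨(2, 1), by decide⟩ := by
  simp only [okCoord, LinearMap.sum_apply, LinearMap.smul_apply, LinearMap.proj_apply, smul_eq_mul]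
  rw [okI_sum]
  rfl

open Finset in
/-- Okubo squares are squares of truncated polynomials, up to constants. -/
lemma okCoord_okMul_self {F : Type} [Field F] [CharP F 3] (x : OkI → F) {i j : ℕ}
    (hi : i < 3) (hj : j < 3) (hij : i + j ≠ 0) :
    okCoord F i j (okMul F x x) = ∑ a ∈ antidiagonal i, ∑ b ∈ antidiagonal j,
      okCoord F a.1 b.1 x * okCoord F a.2 b.2 x := by
  obtain ⟨h1, h2, h3, h4, h5, h6, h7, h8⟩ := okMul_components x x
  simp only [okCoord_expand, h1, h2, h3, h4, h5, h6, h7, h8]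
  generalize x ⟨(1, 0), _⟩ = a₁, x ⟨(2, 0), _⟩ = a₂, x ⟨(0, 1), _⟩ = a₃, x ⟨(0, 2), _⟩ = a₄,
    x ⟨(1, 1), _⟩ = a₅, x ⟨(2, 2), _⟩ = a₆, x ⟨(1, 2), _⟩ = a₇, x ⟨(2, 1), _⟩ = a₈
  clear h1 h2 h3 h4 h5 h6 h7 h8
  interval_cases i <;> interval_cases j
  · simp at hij
  all_goals
    simp [Nat.choose, Finset.Nat.antidiagonal_succ]
    grind

open Finset in
set_option maxHeartbeats 1000000 in
/-- The Jacobian determinant of the truncated polynomials of commuting elements vanishes. -/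
lemma okCoord_jacobian {F : Type} [Field F] [CharP F 3] (x y : OkI → F)
    (h : okMul F x y = okMul F y x) {i j : ℕ} (hi : i < 3) (hj : j < 3) :
    ∑ a ∈ antidiagonal i, ∑ b ∈ antidiagonal j,
      ((a.1 + 1) * (b.2 + 1) * okCoord F (a.1 + 1) b.1 x * okCoord F a.2 (b.2 + 1) y -
       (b.1 + 1) * (a.2 + 1) * okCoord F a.1 (b.1 + 1) x * okCoord F (a.2 + 1) b.2 y) = 0 := by
  have hcomm : ∑ k : OkI, (((k.1.1 - 1).val.choose i * (k.1.2 - 1).val.choose j : ℕ) : F) *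
      (okMul F x y k - okMul F y x k) = 0 := by simp [h]
  refine Eq.trans ?_ hcomm
  obtain ⟨h1, h2, h3, h4, h5, h6, h7, h8⟩ := okMul_components x y
  obtain ⟨k1, k2, k3, k4, k5, k6, k7, k8⟩ := okMul_components y x
  rw [okI_sum]
  simp only [okCoord_expand, h1, h2, h3, h4, h5, h6, h7, h8, k1, k2, k3, k4, k5, k6, k7, k8,
    show (ZMod.val (1 - 1 : ZMod 3)) = 0 from rfl, show (ZMod.val (2 - 1 : ZMod 3)) = 1 from rfl,
    show (ZMod.val (0 - 1 : ZMod 3)) = 2 from rfl]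
  clear h1 h2 h3 h4 h5 h6 h7 h8 k1 k2 k3 k4 k5 k6 k7 k8 hcomm h
  generalize x ⟨(1, 0), _⟩ = a₁, x ⟨(2, 0), _⟩ = a₂, x ⟨(0, 1), _⟩ = a₃, x ⟨(0, 2), _⟩ = a₄,
    x ⟨(1, 1), _⟩ = a₅, x ⟨(2, 2), _⟩ = a₆, x ⟨(1, 2), _⟩ = a₇, x ⟨(2, 1), _⟩ = a₈
  generalize y ⟨(1, 0), _⟩ = b₁, y ⟨(2, 0), _⟩ = b₂, y ⟨(0, 1), _⟩ = b₃, y ⟨(0, 2), _⟩ = b₄,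
    y ⟨(1, 1), _⟩ = b₅, y ⟨(2, 2), _⟩ = b₆, y ⟨(1, 2), _⟩ = b₇, y ⟨(2, 1), _⟩ = b₈
  interval_cases i <;> interval_cases j
  all_goals
    simp [Nat.choose, Finset.Nat.antidiagonal_succ]
    grind

lemma okI_forall {P : OkI → Prop} (h10 : P ⟨(1, 0), by decide⟩) (h20 : P ⟨(2, 0), by decide⟩)
    (h01 : P ⟨(0, 1), by decide⟩) (h02 : P ⟨(0, 2), by decide⟩) (h11 : P ⟨(1, 1), by decide⟩)
    (h22 : P ⟨(2, 2), by decide⟩) (h12 : P ⟨(1, 2), by decide⟩) (h21 : P ⟨(2, 1), by decide⟩)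
    (k : OkI) : P k := by
  obtain ⟨⟨g, h⟩, hk⟩ := k
  obtain rfl | rfl | rfl : g = 0 ∨ g = 1 ∨ g = 2 := by clear hk; revert g; decide
  all_goals
    obtain rfl | rfl | rfl : h = 0 ∨ h = 1 ∨ h = 2 := by clear hk; revert h; decide
  · exact absurd rfl hk
  all_goals assumption

/-- The coordinates `okCoord R i j` with `(i, j) ≠ (0, 0)` separate points. -/
lemma eq_zero_of_okCoord_eq_zero {R : Type} [CommRing R] {x : OkI → R}
    (h10 : okCoord R 1 0 x = 0) (h01 : okCoord R 0 1 x = 0) (h20 : okCoord R 2 0 x = 0)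
    (h11 : okCoord R 1 1 x = 0) (h02 : okCoord R 0 2 x = 0) (h21 : okCoord R 2 1 x = 0)
    (h12 : okCoord R 1 2 x = 0) (h22 : okCoord R 2 2 x = 0) : x = 0 := by
  simp [okCoord_expand, Nat.choose] at h10 h01 h20 h11 h02 h21 h12 h22
  refine funext (okI_forall ?_ ?_ ?_ ?_ ?_ ?_ ?_ ?_) <;> simp only [Pi.zero_apply] <;> grind

lemma exists_mem_okCent {F : Type} [Field F] {f : OkI → F}
    (h : Module.finrank F (okCent F f) = 6) (l : Fin 5 → Module.Dual F (OkI → F)) :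
    ∃ x, okMul F x f = okMul F f x ∧ x ≠ 0 ∧ ∀ i, l i x = 0 := by
  have hk := LinearMap.ker_ne_bot_of_finrank_lt
    (f := (LinearMap.pi l).comp (okCent F f).subtype) (by simp [h])
  obtain ⟨x, hx, hx0⟩ := (Submodule.ne_bot_iff _).1 hk
  refine ⟨x, x.2, by simpa using hx0, fun i => ?_⟩
  exact congrFun (LinearMap.mem_ker.1 hx) i

lemma oke_apply {R : Type} [CommRing R] (g : OkI) : oke R g = 1 := by
  simp [oke, okE, Finset.sum_apply, Pi.single_apply]

lemma okCent_oke {F : Type} [Field F] [CharP F 3] :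
    okCent F (oke F) = LinearMap.ker ((okCoord F 1 0).prod (okCoord F 0 1)) := by
  ext x
  have h3 : (3 : F) = 0 := by exact_mod_cast CharP.cast_eq_zero F 3
  obtain ⟨h1, h2, h3, h4, h5, h6, h7, h8⟩ := okMul_components x (oke F)
  obtain ⟨k1, k2, k3, k4, k5, k6, k7, k8⟩ := okMul_components (oke F) x
  have hmem : x ∈ okCent F (oke F) ↔ okMul F x (oke F) = okMul F (oke F) x := Iff.rfl
  simp only [oke_apply] at h1 h2 h3 h4 h5 h6 h7 h8 k1 k2 k3 k4 k5 k6 k7 k8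
  rw [hmem, LinearMap.mem_ker]
  simp [okCoord_expand, Nat.choose, Prod.ext_iff]
  constructor
  · intro h
    rw [h] at h1 h2 h3 h4 h5 h6 h7 h8
    constructor <;> grind
  · rintro ⟨ha, hb⟩
    refine funext (okI_forall ?_ ?_ ?_ ?_ ?_ ?_ ?_ ?_) <;> grind

lemma finrank_okCent_oke {F : Type} [Field F] [CharP F 3] :
    Module.finrank F (okCent F (oke F)) = 6 := by
  set φ := (okCoord F 1 0).prod (okCoord F 0 1) with hφ
  have hs : LinearMap.range φ = ⊤ := by
    rw [LinearMap.range_eq_top]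
    rintro ⟨a, b⟩
    refine ⟨Pi.single ⟨(1, 0), by decide⟩ a + Pi.single ⟨(0, 1), by decide⟩ b, ?_⟩
    simp +decide [hφ, okCoord_expand, Nat.choose]
  have hc := φ.finrank_range_add_finrank_ker
  rw [hs, finrank_top, Module.finrank_prod, Module.finrank_self, Module.finrank_fintype_fun_eq_card,
    show Fintype.card OkI = 8 by decide] at hc
  rw [okCent_oke, ← hφ]
  omega

open Finset in
lemma okCoord_idempotent {F : Type} [Field F] [CharP F 3] {f : OkI → F}
    (hf : okMul F f f = f) (hf0 : f ≠ 0) :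
    2 * okCoord F 0 0 f = 1 ∧ okCoord F 1 0 f = 0 ∧ okCoord F 0 1 f = 0 ∧
      okCoord F 1 1 f ^ 2 + 2 * okCoord F 2 0 f * okCoord F 0 2 f = 0 := by
  have S {i j : ℕ} (hi : i < 3) (hj : j < 3) (hij : i + j ≠ 0) := okCoord_okMul_self f hi hj hij
  rw [hf] at S
  have S10 := S (i := 1) (j := 0) (by simp) (by simp) (by simp)
  have S01 := S (i := 0) (j := 1) (by simp) (by simp) (by simp)
  have S20 := S (i := 2) (j := 0) (by simp) (by simp) (by simp)
  have S11 := S (i := 1) (j := 1) (by simp) (by simp) (by simp)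
  have S02 := S (i := 0) (j := 2) (by simp) (by simp) (by simp)
  have S21 := S (i := 2) (j := 1) (by simp) (by simp) (by simp)
  have S12 := S (i := 1) (j := 2) (by simp) (by simp) (by simp)
  have S22 := S (i := 2) (j := 2) (by simp) (by simp) (by simp)
  simp only [Nat.antidiagonal_succ, Nat.antidiagonal_zero, sum_cons, map_singleton,
    sum_singleton, Finset.map_cons, Function.Embedding.prodMap, Function.Embedding.coeFn_mk,
    Prod.map, Function.Embedding.refl_apply, Nat.succ_eq_add_one, zero_add, Nat.reduceAdd]
    at S10 S01 S20 S11 S02 S21 S12 S22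
  have ha : 2 * okCoord F 0 0 f = 1 := by
    by_contra ha
    refine hf0 ?_
    have hz {t : F} (ht : t = 2 * okCoord F 0 0 f * t) : t = 0 := by
      by_contra h
      exact ha (mul_right_cancel₀ h (by rw [one_mul, ← ht]))
    have h10 := hz (t := okCoord F 1 0 f) (by linear_combination S10)
    have h01 := hz (t := okCoord F 0 1 f) (by linear_combination S01)
    rw [h10] at S20 S11 S21 S12 S22
    rw [h01] at S02 S11 S21 S12 S22
    have h20 := hz (t := okCoord F 2 0 f) (by linear_combination S20)
    have h02 := hz (t := okCoord F 0 2 f) (by linear_combination S02)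
    have h11 := hz (t := okCoord F 1 1 f) (by linear_combination S11)
    rw [h20, h11] at S21 S22
    rw [h02, h11] at S12
    have h21 := hz (t := okCoord F 2 1 f) (by linear_combination S21)
    have h12 := hz (t := okCoord F 1 2 f) (by linear_combination S12)
    have h22 := hz (t := okCoord F 2 2 f) (by linear_combination S22)
    exact eq_zero_of_okCoord_eq_zero h10 h01 h20 h11 h02 h21 h12 h22
  have h10 : okCoord F 1 0 f = 0 := by
    refine pow_eq_zero_iff (two_ne_zero) |>.1 ?_
    linear_combination -okCoord F 2 0 f * ha - S20
  have h01 : okCoord F 0 1 f = 0 := by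
    refine pow_eq_zero_iff (two_ne_zero) |>.1 ?_
    linear_combination -okCoord F 0 2 f * ha - S02
  refine ⟨ha, h10, h01, ?_⟩
  rw [h10, h01] at S22
  linear_combination -okCoord F 2 2 f * ha - S22

open Finset in
lemma okCoord_eq_zero_of_finrank {F : Type} [Field F] [CharP F 3] {f : OkI → F}
    (h : Module.finrank F (okCent F f) = 6)
    (h10 : okCoord F 1 0 f = 0) (h01 : okCoord F 0 1 f = 0)
    (hq : okCoord F 1 1 f ^ 2 + 2 * okCoord F 2 0 f * okCoord F 0 2 f = 0) :
    okCoord F 2 0 f = 0 ∧ okCoord F 1 1 f = 0 ∧ okCoord F 0 2 f = 0 ∧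
      okCoord F 2 1 f = 0 ∧ okCoord F 1 2 f = 0 := by
  have h2 : (2 : F) ≠ 0 := by
    intro h2
    have h3 : (3 : F) = 0 := by exact_mod_cast CharP.cast_eq_zero F 3
    exact one_ne_zero (α := F) (by linear_combination h3 - h2)
  have J {y : OkI → F} (hy : okMul F y f = okMul F f y) {i j : ℕ} (hi : i < 3) (hj : j < 3) :=
    okCoord_jacobian f y hy.symm hi hj
  have h20 : okCoord F 2 0 f = 0 := by
    by_contra hα
    obtain ⟨y, hy, hy0, hl⟩ := exists_mem_okCent h
      ![okCoord F 1 0, okCoord F 2 0, okCoord F 2 1, okCoord F 1 2, okCoord F 2 2]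
    simp only [Fin.forall_fin_succ, Matrix.cons_val_zero, Matrix.cons_val_succ] at hl
    obtain ⟨k10, k20, k21, k12, k22, -⟩ := hl
    have J10 := J hy (i := 1) (j := 0) (by simp) (by simp)
    have J20 := J hy (i := 2) (j := 0) (by simp) (by simp)
    have J11 := J hy (i := 1) (j := 1) (by simp) (by simp)
    clear J h
    simp [Nat.antidiagonal_succ, h10, h01, k10, k20, k21, k12]
      at J10 J20 J11
    have k01 : okCoord F 0 1 y = 0 := by grind
    have k11 : okCoord F 1 1 y = 0 := by grind
    have k02 : okCoord F 0 2 y = 0 := by grind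
    exact hy0 (eq_zero_of_okCoord_eq_zero k10 k01 k20 k11 k02 k21 k12 k22)
  have h02 : okCoord F 0 2 f = 0 := by
    by_contra hγ
    obtain ⟨y, hy, hy0, hl⟩ := exists_mem_okCent h
      ![okCoord F 0 1, okCoord F 0 2, okCoord F 2 1, okCoord F 1 2, okCoord F 2 2]
    simp only [Fin.forall_fin_succ, Matrix.cons_val_zero, Matrix.cons_val_succ] at hl
    obtain ⟨k01, k02, k21, k12, k22, -⟩ := hl
    have J01 := J hy (i := 0) (j := 1) (by simp) (by simp)
    have J02 := J hy (i := 0) (j := 2) (by simp) (by simp)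
    have J11 := J hy (i := 1) (j := 1) (by simp) (by simp)
    clear J h
    simp [Nat.antidiagonal_succ, h10, h01, h20, k01, k02, k21, k12]
      at J01 J02 J11
    have k10 : okCoord F 1 0 y = 0 := by grind
    have k11 : okCoord F 1 1 y = 0 := by grind
    have k20 : okCoord F 2 0 y = 0 := by grind
    exact hy0 (eq_zero_of_okCoord_eq_zero k10 k01 k20 k11 k02 k21 k12 k22)
  have h11 : okCoord F 1 1 f = 0 := by simpa [h20] using hq
  suffices h : okCoord F 2 1 f = 0 ∧ okCoord F 1 2 f = 0 from ⟨h20, h11, h02, h⟩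
  by_contra hab
  obtain ⟨y, hy, hy0, hl⟩ := exists_mem_okCent h
    ![okCoord F 2 0, okCoord F 0 2, okCoord F 2 1, okCoord F 1 2, okCoord F 2 2]
  simp only [Fin.forall_fin_succ, Matrix.cons_val_zero, Matrix.cons_val_succ] at hl
  obtain ⟨k20, k02, k21, k12, k22, -⟩ := hl
  have J20 := J hy (i := 2) (j := 0) (by simp) (by simp)
  have J11 := J hy (i := 1) (j := 1) (by simp) (by simp)
  have J02 := J hy (i := 0) (j := 2) (by simp) (by simp)
  have J21 := J hy (i := 2) (j := 1) (by simp) (by simp)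
  have J12 := J hy (i := 1) (j := 2) (by simp) (by simp)
  clear J h
  simp [Nat.antidiagonal_succ, h10, h01, h20, h11, h02, k20, k02, k21, k12,
    k22] at J20 J11 J02 J21 J12
  have k10 : okCoord F 1 0 y = 0 := by grind
  have k01 : okCoord F 0 1 y = 0 := by grind
  have k11 : okCoord F 1 1 y = 0 := by grind
  exact hy0 (eq_zero_of_okCoord_eq_zero k10 k01 k20 k11 k02 k21 k12 k22)

lemma okCoord_oke (F : Type) [Field F] [CharP F 3] {i j : ℕ} (hi : i < 3) (hj : j < 3)
    (hij : i < 2 ∨ j < 2) (h : i + j ≠ 0) : okCoord F i j (oke F) = 0 := by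
  simp only [okCoord_expand, oke_apply]
  interval_cases i <;> interval_cases j <;> simp [Nat.choose] at hij h ⊢ <;> grind

/-- Over an algebraically closed field of characteristic `3`, a nonzero
idempotent `f` of the split Okubo algebra is quaternionic (its centralizer has dimension
`6`) if and only if `f = e`, the sum of all eight basis elements; in particular the split
Okubo algebra has a unique quaternionic idempotent. -/
theorem okubo_unique_quaternionic_idempotent (F : Type) [Field F] [IsAlgClosed F]
    [CharP F 3] (f : OkI → F) (hf : okMul F f f = f) (hf0 : f ≠ 0) :
    Module.finrank F (okCent F f) = 6 ↔ f = oke F := by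
  refine ⟨fun h => ?_, fun h => h ▸ finrank_okCent_oke⟩
  obtain ⟨h00, h10, h01, hq⟩ := okCoord_idempotent hf hf0
  obtain ⟨h20, h11, h02, h21, h12⟩ := okCoord_eq_zero_of_finrank h h10 h01 hq
  have he {i j : ℕ} (hi : i < 3) (hj : j < 3) (hij : i < 2 ∨ j < 2) (h : i + j ≠ 0) :=
    okCoord_oke F hi hj hij h
  have he22 : okCoord F 2 2 (oke F) = 1 := by
    simp [okCoord_expand, oke_apply, Nat.choose]
  have hfe : f = okCoord F 2 2 f • oke F := by
    rw [← sub_eq_zero]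
    apply eq_zero_of_okCoord_eq_zero <;> simp [*]
  have he00 : okCoord F 0 0 (oke F) = 8 := by
    simp [okCoord_expand, oke_apply]
    norm_num
  have h1 : okCoord F 2 2 f = 1 := by
    have h := congrArg (okCoord F 0 0) hfe
    rw [map_smul, he00, smul_eq_mul] at h
    grind
  rw [hfe, h1, one_smul]
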